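/- arXiv:2509.13086 — 6 statements merged into one kernel-verified Lean document; each statement's English description precedes it below -/
import Mathlib

section
/- Let c0, C1, C2, α, μ0, λ be real numbers with 0 < α < c0, 0 < μ0 < 1, λ > 0, and λ·(C1 + α·C2) ≤ μ0·α·(c0 − α). Let L11, L12, L22 ∈ ℝ satisfy |L11| ≥ c0, |L11·L22 − L12²| ≤ C1, and |L22| ≤ C2. Then for all a, b ∈ ℝ with |b| ≤ α·|a|, setting a' = a·L11 + b and b' = λ·a·(L11·L22 − L12²) + λ·b·L22, one has |b'| ≤ μ0·α·|a'|. -/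
/-- Core estimate in the cone-field criterion for strongly dissipative symplectic
billiards: the horizontal cone of aperture `α` is mapped into the cone of aperture
`μ0·α`. -/
theorem cone_field_criterion_estimate (c0 C1 C2 α μ0 lam : ℝ)
    (hα0 : 0 < α) (hαc0 : α < c0) (hμ0 : 0 < μ0) (hμ1 : μ0 < 1) (hlam : 0 < lam)
    (hlam' : lam * (C1 + α * C2) ≤ μ0 * α * (c0 - α))
    (L11 L12 L22 : ℝ) (h11 : |L11| ≥ c0) (h1 : |L11 * L22 - L12 ^ 2| ≤ C1)
    (h22 : |L22| ≤ C2) :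
    ∀ a b : ℝ, |b| ≤ α * |a| →
      |lam * a * (L11 * L22 - L12 ^ 2) + lam * b * L22| ≤ μ0 * α * |a * L11 + b| := by
  intro a b hb
  have lower : (c0 - α) * |a| ≤ |a * L11 + b| := by
    have h := abs_sub_abs_le_abs_sub (a * L11) (-b)
    rw [abs_neg, sub_neg_eq_add, abs_mul] at h
    have := mul_le_mul_of_nonneg_left h11 (abs_nonneg a)
    linarith
  calc |lam * a * (L11 * L22 - L12 ^ 2) + lam * b * L22|
      ≤ lam * |a| * |L11 * L22 - L12 ^ 2| + lam * |b| * |L22| := by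
        refine (abs_add_le _ _).trans_eq ?_
        simp only [abs_mul, abs_of_pos hlam]
    _ ≤ lam * |a| * C1 + lam * (α * |a|) * C2 := by gcongr
    _ = lam * (C1 + α * C2) * |a| := by ring
    _ ≤ μ0 * α * (c0 - α) * |a| := by gcongr
    _ = μ0 * α * ((c0 - α) * |a|) := by ring
    _ ≤ μ0 * α * |a * L11 + b| := by gcongr
end

section
/- Let a, b, c, λ ∈ ℝ with c ≠ 0. Define the 2×2 real matrices M1 = −(1/c)·[[a, 1], [−λ·c² + λ·a·b, λ·b]] and M2 = −(1/c)·[[b, 1], [−λ·c² + λ·a·b, λ·a]]. Then the product A = M2 · M1 satisfies det A = λ² and trace A = −2λ + (1+λ)²·(a·b)/c². -/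
/-- Determinant and trace of the differential `DT_λ²` at a 4-periodic point of a
centrally symmetric dissipative symplectic billiard. -/
theorem det_trace_DT_sq (a b c lam : ℝ) (hc : c ≠ 0) :
    (((-(1 / c)) • !![b, 1; -lam * c ^ 2 + lam * a * b, lam * a] *
        ((-(1 / c)) • !![a, 1; -lam * c ^ 2 + lam * a * b, lam * b]) :
        Matrix (Fin 2) (Fin 2) ℝ)).det = lam ^ 2 ∧
    (((-(1 / c)) • !![b, 1; -lam * c ^ 2 + lam * a * b, lam * a] *
        ((-(1 / c)) • !![a, 1; -lam * c ^ 2 + lam * a * b, lam * b]) :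
        Matrix (Fin 2) (Fin 2) ℝ)).trace
      = -2 * lam + (1 + lam) ^ 2 * (a * b) / c ^ 2 := by
  constructor
  · simp only [Matrix.det_mul, Matrix.det_smul, Matrix.det_fin_two_of, Fintype.card_fin]
    field_simp
    ring
  · simp only [Matrix.smul_mul, Matrix.mul_smul, Matrix.trace_smul, Matrix.mul_fin_two,
      Matrix.trace_fin_two_of, smul_eq_mul]
    field_simp
    ring
end

section
/- Let k ∈ (0,1), set λ₋ = (1 − √(1−k))/(1 + √(1−k)), and consider the quadratic polynomial χ(x) = x² − ((1+λ)²·k − 2λ)·x + λ². Then λ₋ ∈ (0,1), and: (i) for every λ ∈ (0, λ₋), χ has two distinct real roots ν1 < ν2 satisfying λ² < ν1 < ν2 < 1; (ii) for λ = λ₋, χ has the double root λ. (Sink case, real-eigenvalue regime, of the classification of 4-periodic points.) -/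
/-- If `2 * a < b < 1 + a ^ 2` with `a ∈ (0, 1)`, then `x ^ 2 - b * x + a ^ 2` has two distinct
real roots, both lying in `(a ^ 2, 1)`. -/
theorem exists_roots_between_sq_and_one {a b : ℝ} (ha0 : 0 < a) (ha1 : a < 1)
    (hlower : 2 * a < b) (hupper : b < 1 + a ^ 2) :
    ∃ ν1 ν2 : ℝ, ν1 < ν2 ∧
      (∀ x : ℝ, x ^ 2 - b * x + a ^ 2 = 0 ↔ x = ν1 ∨ x = ν2) ∧ a ^ 2 < ν1 ∧ ν2 < 1 := by
  have hdisc : 0 < b ^ 2 - 4 * a ^ 2 := by nlinarith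
  have hd0 : 0 < Real.sqrt (b ^ 2 - 4 * a ^ 2) := Real.sqrt_pos.mpr hdisc
  have hd2 : Real.sqrt (b ^ 2 - 4 * a ^ 2) ^ 2 = b ^ 2 - 4 * a ^ 2 := Real.sq_sqrt hdisc.le
  have hd_lt_low : Real.sqrt (b ^ 2 - 4 * a ^ 2) < b - 2 * a ^ 2 := by
    rw [Real.sqrt_lt' (by nlinarith)]
    have h : 0 < a ^ 2 * (1 + a ^ 2 - b) := mul_pos (by positivity) (by linarith)
    linarith
  have hd_lt_up : Real.sqrt (b ^ 2 - 4 * a ^ 2) < 2 - b := by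
    rw [Real.sqrt_lt' (by nlinarith)]
    linarith
  generalize Real.sqrt (b ^ 2 - 4 * a ^ 2) = d at *
  refine ⟨(b - d) / 2, (b + d) / 2, by linarith, fun x => ?_, by linarith, by linarith⟩
  have hfactor : x ^ 2 - b * x + a ^ 2 = (x - (b - d) / 2) * (x - (b + d) / 2) := by
    linarith
  rw [hfactor, mul_eq_zero, sub_eq_zero, sub_eq_zero]

/-- Sink case (real-eigenvalue regime) of the classification of 4-periodic points:
for `k ∈ (0,1)` and `λ₋ = (1 − √(1−k))/(1 + √(1−k))`, one has `λ₋ ∈ (0,1)`; for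
`λ ∈ (0,λ₋)` the polynomial `χ` has two distinct real roots `ν1 < ν2` with
`λ² < ν1 < ν2 < 1`, and for `λ = λ₋` it has the double root `λ₋`. -/
theorem sink_case_real (k : ℝ) (hk0 : 0 < k) (hk1 : k < 1) :
    0 < (1 - Real.sqrt (1 - k)) / (1 + Real.sqrt (1 - k)) ∧
    (1 - Real.sqrt (1 - k)) / (1 + Real.sqrt (1 - k)) < 1 ∧
    (∀ lam : ℝ, 0 < lam → lam < (1 - Real.sqrt (1 - k)) / (1 + Real.sqrt (1 - k)) →
      ∃ ν1 ν2 : ℝ, ν1 < ν2 ∧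
        (∀ x : ℝ, x ^ 2 - ((1 + lam) ^ 2 * k - 2 * lam) * x + lam ^ 2 = 0 ↔
          x = ν1 ∨ x = ν2) ∧
        lam ^ 2 < ν1 ∧ ν2 < 1) ∧
    (∀ x : ℝ,
      x ^ 2 - ((1 + (1 - Real.sqrt (1 - k)) / (1 + Real.sqrt (1 - k))) ^ 2 * k
          - 2 * ((1 - Real.sqrt (1 - k)) / (1 + Real.sqrt (1 - k)))) * x
        + ((1 - Real.sqrt (1 - k)) / (1 + Real.sqrt (1 - k))) ^ 2
      = (x - (1 - Real.sqrt (1 - k)) / (1 + Real.sqrt (1 - k))) ^ 2) := by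
  set s := Real.sqrt (1 - k)
  have hs0 : 0 < s := Real.sqrt_pos.mpr (by linarith)
  have hsq : s ^ 2 = 1 - k := Real.sq_sqrt (by linarith)
  have hs1 : s < 1 := by nlinarith
  have hk : k = 1 - s ^ 2 := by linarith
  refine ⟨div_pos (by linarith) (by linarith), (div_lt_one (by linarith)).mpr (by linarith),
    ?_, ?_⟩
  · intro lam hl0 hl
    rw [lt_div_iff₀ (by linarith)] at hl
    have hl1 : lam < 1 := by nlinarith
    have hlower : 2 * lam < (1 + lam) ^ 2 * k - 2 * lam := by
      have h : (s * (1 + lam)) ^ 2 < (1 - lam) ^ 2 :=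
        pow_lt_pow_left₀ (by linarith) (by positivity) (by norm_num)
      rw [hk]
      linarith
    have hupper : (1 + lam) ^ 2 * k - 2 * lam < 1 + lam ^ 2 := by
      have h : (1 + lam) ^ 2 * k < (1 + lam) ^ 2 * 1 :=
        mul_lt_mul_of_pos_left hk1 (by positivity)
      linarith
    exact exists_roots_between_sq_and_one hl0 hl1 hlower hupper
  · intro x
    rw [hk]
    field_simp
    ring
end

section
/- Let p : ℝ → ℝ be three times differentiable. For θ ∈ ℝ set e_θ = (−sin θ, cos θ), J e_θ = (−cos θ, −sin θ), γ(θ) = p'(θ)·e_θ − p(θ)·J e_θ and ρ(θ) = p(θ) + p''(θ). Let θ1, θ2 ∈ ℝ with p(θ1) > 0 and p(θ2) > 0, and assume det(e_{θ1}, γ(θ2)) = 0 and det(e_{θ2}, γ(θ1)) = 0. Then sin(θ2 − θ1) ≠ 0 and det(γ''(θ1), γ(θ2)) · det(γ(θ1), γ''(θ2)) = ρ(θ1)·ρ(θ2)·p(θ1)·p(θ2) / sin²(θ2 − θ1). -/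
/-- Determinant of the 2×2 matrix with columns `u` and `v` in `ℝ²`. -/
def det2 (u v : ℝ × ℝ) : ℝ := u.1 * v.2 - u.2 * v.1

/-- Unit tangent direction forming angle `θ` with the vertical `(0,1)`. -/
noncomputable def eVec (θ : ℝ) : ℝ × ℝ := (-Real.sin θ, Real.cos θ)

/-- Rotation by `π/2` of `eVec θ`. -/
noncomputable def JeVec (θ : ℝ) : ℝ × ℝ := (-Real.cos θ, -Real.sin θ)

/-- The curve with support function `p`, parametrized by tangent angle. -/
noncomputable def suppCurve (p : ℝ → ℝ) (θ : ℝ) : ℝ × ℝ :=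
  deriv p θ • eVec θ - p θ • JeVec θ

theorem hasDerivAt_eVec (θ : ℝ) : HasDerivAt eVec (JeVec θ) θ :=
  (Real.hasDerivAt_sin θ).neg.prodMk (Real.hasDerivAt_cos θ)

theorem hasDerivAt_JeVec (θ : ℝ) : HasDerivAt JeVec (-eVec θ) θ :=
  (Real.hasDerivAt_cos θ).neg.prodMk (Real.hasDerivAt_sin θ).neg

theorem deriv_suppCurve {p : ℝ → ℝ} (h1 : Differentiable ℝ p)
    (h2 : Differentiable ℝ (deriv p)) :
    deriv (suppCurve p) = fun θ => (p θ + deriv (deriv p) θ) • eVec θ := by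
  funext θ
  have h : HasDerivAt (suppCurve p) _ θ :=
    ((h2 θ).hasDerivAt.smul (hasDerivAt_eVec θ)).sub
      ((h1 θ).hasDerivAt.smul (hasDerivAt_JeVec θ))
  rw [h.deriv]
  module

theorem deriv_deriv_suppCurve {p : ℝ → ℝ} (h1 : Differentiable ℝ p)
    (h2 : Differentiable ℝ (deriv p)) (h3 : Differentiable ℝ (deriv (deriv p))) (θ : ℝ) :
    deriv (deriv (suppCurve p)) θ =
      (p θ + deriv (deriv p) θ) • JeVec θ +
        (deriv p θ + deriv (deriv (deriv p)) θ) • eVec θ := by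
  rw [deriv_suppCurve h1 h2]
  exact (((h1 θ).hasDerivAt.add (h3 θ).hasDerivAt).smul (hasDerivAt_eVec θ)).deriv

theorem det2_swap (u v : ℝ × ℝ) : det2 u v = -det2 v u := by
  simp only [det2]
  ring

theorem det2_smul_add_smul_left (a b : ℝ) (u v w : ℝ × ℝ) :
    det2 (a • u + b • v) w = a * det2 u w + b * det2 v w := by
  simp only [det2, Prod.fst_add, Prod.snd_add, Prod.smul_fst, Prod.smul_snd, smul_eq_mul]
  ring

theorem det2_eVec_suppCurve (p : ℝ → ℝ) (α β : ℝ) :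
    det2 (eVec α) (suppCurve p β) =
      deriv p β * Real.sin (β - α) - p β * Real.cos (β - α) := by
  simp only [det2, eVec, JeVec, suppCurve, Prod.fst_sub, Prod.snd_sub, Prod.smul_fst,
    Prod.smul_snd, smul_eq_mul, Real.sin_sub, Real.cos_sub]
  ring

theorem det2_JeVec_suppCurve (p : ℝ → ℝ) (α β : ℝ) :
    det2 (JeVec α) (suppCurve p β) =
      -(deriv p β * Real.cos (β - α) + p β * Real.sin (β - α)) := by
  simp only [det2, eVec, JeVec, suppCurve, Prod.fst_sub, Prod.snd_sub, Prod.smul_fst,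
    Prod.smul_snd, smul_eq_mul, Real.sin_sub, Real.cos_sub]
  ring

theorem sin_sub_ne_zero_of_det2_eq_zero {p : ℝ → ℝ} {α β : ℝ} (hp : p β ≠ 0)
    (he : det2 (eVec α) (suppCurve p β) = 0) : Real.sin (β - α) ≠ 0 := by
  intro hs
  rw [det2_eVec_suppCurve, hs, mul_zero, zero_sub, neg_eq_zero] at he
  have hc := (mul_eq_zero.mp he).resolve_left hp
  have := Real.sin_sq_add_cos_sq (β - α)
  simp [hs, hc] at this

theorem det2_JeVec_suppCurve_of_det2_eq_zero {p : ℝ → ℝ} {α β : ℝ} (hp : p β ≠ 0)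
    (he : det2 (eVec α) (suppCurve p β) = 0) :
    det2 (JeVec α) (suppCurve p β) = -p β / Real.sin (β - α) := by
  rw [eq_div_iff (sin_sub_ne_zero_of_det2_eq_zero hp he), det2_JeVec_suppCurve]
  rw [det2_eVec_suppCurve] at he
  linear_combination -Real.cos (β - α) * he - p β * Real.sin_sq_add_cos_sq (β - α)

/-- The second derivative of the generating function at a critical point. -/
theorem det2_deriv_deriv_suppCurve {p : ℝ → ℝ} (h1 : Differentiable ℝ p)
    (h2 : Differentiable ℝ (deriv p)) (h3 : Differentiable ℝ (deriv (deriv p)))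
    {α β : ℝ} (hp : p β ≠ 0) (he : det2 (eVec α) (suppCurve p β) = 0) :
    det2 (deriv (deriv (suppCurve p)) α) (suppCurve p β) =
      (p α + deriv (deriv p) α) * (-p β / Real.sin (β - α)) := by
  rw [deriv_deriv_suppCurve h1 h2 h3, det2_smul_add_smul_left, he,
    det2_JeVec_suppCurve_of_det2_eq_zero hp he, mul_zero, add_zero]

/-- Product `L11·L22` at a 4-periodic configuration:
`det(γ''(θ1), γ(θ2)) · det(γ(θ1), γ''(θ2)) = ρ(θ1)ρ(θ2)p(θ1)p(θ2)/sin²(θ2−θ1)`. -/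
theorem L11_mul_L22_at_four_periodic (p : ℝ → ℝ) (h1 : Differentiable ℝ p)
    (h2 : Differentiable ℝ (deriv p)) (h3 : Differentiable ℝ (deriv (deriv p)))
    (θ1 θ2 : ℝ) (hp1 : 0 < p θ1) (hp2 : 0 < p θ2)
    (he1 : det2 (eVec θ1) (suppCurve p θ2) = 0)
    (he2 : det2 (eVec θ2) (suppCurve p θ1) = 0) :
    Real.sin (θ2 - θ1) ≠ 0 ∧
    det2 (deriv (deriv (suppCurve p)) θ1) (suppCurve p θ2)
        * det2 (suppCurve p θ1) (deriv (deriv (suppCurve p)) θ2)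
      = (p θ1 + deriv (deriv p) θ1) * (p θ2 + deriv (deriv p) θ2)
          * p θ1 * p θ2 / Real.sin (θ2 - θ1) ^ 2 := by
  have hs := sin_sub_ne_zero_of_det2_eq_zero hp2.ne' he1
  refine ⟨hs, ?_⟩
  rw [det2_swap (suppCurve p θ1), det2_deriv_deriv_suppCurve h1 h2 h3 hp2.ne' he1,
    det2_deriv_deriv_suppCurve h1 h2 h3 hp1.ne' he2, ← neg_sub θ2 θ1, Real.sin_neg]
  field_simp
end

section
/- Let p : ℝ → ℝ be three times differentiable. For θ ∈ ℝ set e_θ = (−sin θ, cos θ), J e_θ = (−cos θ, −sin θ), γ(θ) = p'(θ)·e_θ − p(θ)·J e_θ and ρ(θ) = p(θ) + p''(θ). Let θ1, θ2 ∈ ℝ with p(θ1) > 0, p(θ2) > 0, ρ(θ1) ≠ 0, ρ(θ2) ≠ 0, and assume det(e_{θ1}, γ(θ2)) = 0 and det(e_{θ2}, γ(θ1)) = 0. Then the quantity k_{1,2} = (det(γ''(θ1), γ(θ2)) · det(γ(θ1), γ''(θ2))) / det(γ'(θ1), γ'(θ2))² satisfies k_{1,2} = ((p'(θ1)² + p(θ1)²)·(p'(θ2)²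 + p(θ2)²)) / (ρ(θ1)·ρ(θ2)·p(θ1)·p(θ2)). -/
/-- The stability quantity `k_{1,2} = (L11·L22)/L12²` at a 4-periodic configuration:
`k_{1,2} = ((p'² + p²)(θ1)·(p'² + p²)(θ2)) / (ρ(θ1)·ρ(θ2)·p(θ1)·p(θ2))`. -/
theorem k12_formula (p : ℝ → ℝ) (h1 : Differentiable ℝ p)
    (h2 : Differentiable ℝ (deriv p)) (h3 : Differentiable ℝ (deriv (deriv p)))
    (θ1 θ2 : ℝ) (hp1 : 0 < p θ1) (hp2 : 0 < p θ2)
    (hρ1 : p θ1 + deriv (deriv p) θ1 ≠ 0) (hρ2 : p θ2 + deriv (deriv p) θ2 ≠ 0)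
    (he1 : det2 (eVec θ1) (suppCurve p θ2) = 0)
    (he2 : det2 (eVec θ2) (suppCurve p θ1) = 0) :
    det2 (deriv (deriv (suppCurve p)) θ1) (suppCurve p θ2)
        * det2 (suppCurve p θ1) (deriv (deriv (suppCurve p)) θ2)
        / det2 (deriv (suppCurve p) θ1) (deriv (suppCurve p) θ2) ^ 2
      = (deriv p θ1 ^ 2 + p θ1 ^ 2) * (deriv p θ2 ^ 2 + p θ2 ^ 2)
          / ((p θ1 + deriv (deriv p) θ1) * (p θ2 + deriv (deriv p) θ2)
            * p θ1 * p θ2) := by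
  rw [deriv_deriv_suppCurve h1 h2 h3, deriv_deriv_suppCurve h1 h2 h3, deriv_suppCurve h1 h2]
  simp only [det2, suppCurve, eVec, JeVec, Prod.fst_add, Prod.snd_add, Prod.fst_sub,
    Prod.snd_sub, Prod.smul_mk, smul_eq_mul] at he1 he2 ⊢
  set r1 := p θ1 + deriv (deriv p) θ1
  set r2 := p θ2 + deriv (deriv p) θ2
  generalize deriv p θ1 + deriv (deriv (deriv p)) θ1 = t1
  generalize deriv p θ2 + deriv (deriv (deriv p)) θ2 = t2
  obtain ⟨S, hS⟩ : ∃ S, S = Real.sin (θ2 - θ1) := ⟨_, rfl⟩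
  obtain ⟨C, hC⟩ : ∃ C, C = Real.cos (θ2 - θ1) := ⟨_, rfl⟩
  have hSC : S ^ 2 + C ^ 2 = 1 := by rw [hS, hC]; exact Real.sin_sq_add_cos_sq _
  rw [Real.sin_sub] at hS
  rw [Real.cos_sub] at hC
  have hq2 : deriv p θ2 * S = p θ2 * C := by rw [hS, hC]; linear_combination he1
  have hq1 : deriv p θ1 * S = -(p θ1 * C) := by rw [hS, hC]; linear_combination -he2
  have hS0 : S ≠ 0 := by
    rintro rfl
    have hC0 : C = 0 := by
      have h : p θ2 * C = 0 := by linarith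
      exact (mul_eq_zero.mp h).resolve_left hp2.ne'
    simp [hC0] at hSC
  have e1 : deriv p θ1 = -(p θ1 * C) / S := by field_simp; linarith
  have e2 : deriv p θ2 = p θ2 * C / S := by field_simp; linarith
  have L12 : r1 * -Real.sin θ1 * (r2 * Real.cos θ2) - r1 * Real.cos θ1 * (r2 * -Real.sin θ2)
      = r1 * r2 * S := by rw [hS]; ring
  have L11 : (r1 * -Real.cos θ1 + t1 * -Real.sin θ1)
        * (deriv p θ2 * Real.cos θ2 - p θ2 * -Real.sin θ2)
      - (r1 * -Real.sin θ1 + t1 * Real.cos θ1)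
        * (deriv p θ2 * -Real.sin θ2 - p θ2 * -Real.cos θ2) = -(r1 * p θ2) / S := by
    trans r1 * (-(deriv p θ2 * C) - p θ2 * S)
    · rw [hS, hC]; linear_combination t1 * he1
    · rw [e2]; field_simp; linear_combination -hSC
  have L22 : (deriv p θ1 * -Real.sin θ1 - p θ1 * -Real.cos θ1)
        * (r2 * -Real.sin θ2 + t2 * Real.cos θ2)
      - (deriv p θ1 * Real.cos θ1 - p θ1 * -Real.sin θ1)
        * (r2 * -Real.cos θ2 + t2 * -Real.sin θ2) = -(r2 * p θ1) / S := by
    trans r2 * (deriv p θ1 * C - p θ1 * S)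
    · rw [hS, hC]; linear_combination -t2 * he2
    · rw [e1]; field_simp; linear_combination -hSC
  have n1 : deriv p θ1 ^ 2 + p θ1 ^ 2 = p θ1 ^ 2 / S ^ 2 := by
    rw [e1]; field_simp; linear_combination hSC
  have n2 : deriv p θ2 ^ 2 + p θ2 ^ 2 = p θ2 ^ 2 / S ^ 2 := by
    rw [e2]; field_simp; linear_combination hSC
  rw [L11, L22, L12, n1, n2]
  have := hp1.ne'
  have := hp2.ne'
  field_simp
end

section
/- Let p : ℝ → ℝ be a C² function with p(θ) > 0 and ρ(θ) := p(θ) + p''(θ) > 0 for all θ. Define Θ(θ) = arctan(p'(θ)/p(θ)) + θ + π/2 and G(θ) = (p'/p)(Θ(θ)) + (p'/p)(θ). Let θ1 ∈ ℝ and set θ2 = Θ(θ1). If G(θ1) = 0 and ((p'(θ1)² + p(θ1)²)·(p'(θ2)² + p(θ2)²)) / (ρ(θ1)·ρ(θ2)·p(θ1)·p(θ2)) = 1, then G'(θ1) = 0. -/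
/-- The map sending a tangent angle to the next tangent angle of a candidate
4-periodic configuration: `Θ(θ) = arctan(p'(θ)/p(θ)) + θ + π/2`. -/
noncomputable def ThetaMap (p : ℝ → ℝ) (θ : ℝ) : ℝ :=
  Real.arctan (deriv p θ / p θ) + θ + Real.pi / 2

/-- The function whose zeros are the tangent angles of 4-periodic orbits:
`G(θ) = (p'/p)(Θ(θ)) + (p'/p)(θ)`. -/
noncomputable def Gmap (p : ℝ → ℝ) (θ : ℝ) : ℝ :=
  deriv p (ThetaMap p θ) / p (ThetaMap p θ) + deriv p θ / p θ

theorem hasDerivAt_deriv_div_self {p : ℝ → ℝ} (hp : ContDiff ℝ 2 p) {θ : ℝ} (h : p θ ≠ 0) :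
    HasDerivAt (fun x => deriv p x / p x)
      ((p θ + deriv (deriv p) θ) / p θ - (1 + (deriv p θ / p θ) ^ 2)) θ := by
  have h₁ : HasDerivAt p (deriv p θ) θ := (hp.differentiable (by norm_num) θ).hasDerivAt
  have h₂ : HasDerivAt (deriv p) (deriv (deriv p) θ) θ :=
    (hp.differentiable_deriv_two θ).hasDerivAt
  refine (h₂.fun_div h₁ h).congr_deriv ?_
  field_simp
  ring

theorem hasDerivAt_ThetaMap {p : ℝ → ℝ} (hp : ContDiff ℝ 2 p) {θ : ℝ} (h : p θ ≠ 0) :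
    HasDerivAt (ThetaMap p)
      ((p θ + deriv (deriv p) θ) / (p θ * (1 + (deriv p θ / p θ) ^ 2))) θ := by
  have hne : 1 + (deriv p θ / p θ) ^ 2 ≠ 0 := by positivity
  unfold ThetaMap
  refine (((hasDerivAt_deriv_div_self hp h).arctan.fun_add (hasDerivAt_id' θ)).add_const
    (Real.pi / 2)).congr_deriv ?_
  generalize deriv p θ / p θ = a at hne ⊢
  field_simp
  ring

theorem hasDerivAt_Gmap {p : ℝ → ℝ} (hp : ContDiff ℝ 2 p) {θ : ℝ} (h : p θ ≠ 0)
    (h' : p (ThetaMap p θ) ≠ 0) :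
    HasDerivAt (Gmap p)
      (((p (ThetaMap p θ) + deriv (deriv p) (ThetaMap p θ)) / p (ThetaMap p θ)
            - (1 + (deriv p (ThetaMap p θ) / p (ThetaMap p θ)) ^ 2))
          * ((p θ + deriv (deriv p) θ) / (p θ * (1 + (deriv p θ / p θ) ^ 2)))
        + ((p θ + deriv (deriv p) θ) / p θ - (1 + (deriv p θ / p θ) ^ 2))) θ :=
  ((hasDerivAt_deriv_div_self hp h').comp θ (hasDerivAt_ThetaMap hp h)).add
    (hasDerivAt_deriv_div_self hp h)

/-- Every degenerate 4-periodic orbit is a critical zero of `G`. -/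
theorem degenerate_four_periodic_critical (p : ℝ → ℝ) (hp : ContDiff ℝ 2 p)
    (hpos : ∀ θ, 0 < p θ) (hρ : ∀ θ, 0 < p θ + deriv (deriv p) θ)
    (θ1 : ℝ) (hG : Gmap p θ1 = 0)
    (hk : (deriv p θ1 ^ 2 + p θ1 ^ 2)
            * (deriv p (ThetaMap p θ1) ^ 2 + p (ThetaMap p θ1) ^ 2)
          / ((p θ1 + deriv (deriv p) θ1)
            * (p (ThetaMap p θ1) + deriv (deriv p) (ThetaMap p θ1))
            * p θ1 * p (ThetaMap p θ1)) = 1) :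
    deriv (Gmap p) θ1 = 0 := by
  have h₁ : p θ1 ≠ 0 := (hpos _).ne'
  have h₂ : p (ThetaMap p θ1) ≠ 0 := (hpos _).ne'
  have hr₁ := (hρ θ1).ne'
  have hr₂ := (hρ (ThetaMap p θ1)).ne'
  rw [(hasDerivAt_Gmap hp h₁ h₂).deriv]
  unfold Gmap at hG
  generalize ThetaMap p θ1 = θ2 at *
  generalize p θ1 + deriv (deriv p) θ1 = r₁ at *
  generalize p θ2 + deriv (deriv p) θ2 = r₂ at *
  obtain ⟨a, ha⟩ : ∃ a, a = deriv p θ1 / p θ1 := ⟨_, rfl⟩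
  have hb : deriv p θ2 / p θ2 = -a := by linarith
  have hd₁ : deriv p θ1 = a * p θ1 := by rw [ha, div_mul_cancel₀ _ h₁]
  have hd₂ : deriv p θ2 = -a * p θ2 := by rw [← hb, div_mul_cancel₀ _ h₂]
  rw [← ha, hb]
  rw [hd₁, hd₂, div_eq_one_iff_eq (by positivity)] at hk
  have hk' : p θ1 * p θ2 * (1 + a ^ 2) ^ 2 = r₁ * r₂ := by
    apply mul_right_cancel₀ (mul_ne_zero h₁ h₂)
    linear_combination hk
  have hne : 1 + a ^ 2 ≠ 0 := by positivity
  field_simp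
  linear_combination -hk'
end
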